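/- arXiv:1302.0881 — 7 statements merged into one kernel-verified Lean document; each statement's English description precedes it below -/
import Mathlib

section
/- Let (p_n)_{n≥0} be real polynomials with deg p_n = n for every n, and let D_p be a linear endomorphism of ℝ[X] such that D_p(p_n) = θ_n·p_n for real numbers θ_n. Let (ε_n)_{n≥1} be real numbers, let ζ be the linear endomorphism of ℝ[X] determined by ζ(p_0) = 0 and ζ(p_n) = ε_n·p_{n−1} for n ≥ 1, and let 𝒟 be the linear endomorphism given by 𝒟(p) = Σ_{j=1}^∞ (−1)^{j+1} ζ^j(p) (a finite sum, since ζ strictly lowers degree). Let P₂ be a real polynomial with P₂(θ_n) ≠ 0 for every n ≥ 0, put γ_{n+1} = P₂(θ_n) for n ≥ 0, let (λ_n)_{n≥0} be real numbers with λ_n − λ_{n−1} = γ_n for n ≥ 1, and assume there exists a polynomial P₁ with λ_n = P₁(θ_n) for all n ≥ 0. Define β_n = ε_n·γ_{n+1}/γ_n for n ≥ 1, and polynomials q_0 = p_0 and q_n = p_n + β_n·p_{n−1} for n ≥ 1. Then the operator D_q = P₁(D_p) + 𝒟 ∘ P₂(D_p) satisfies D_q(q_n) = λ_n·q_n for all n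 ≥ 0. -/
open Polynomial

/-- Peeling off the first power of `ζ` in the truncated series `∑ (-1)^(j+1) ζ^j`. -/
theorem sum_alternating_pow_apply_of_apply_eq_smul {R M : Type*} [CommRing R] [AddCommGroup M]
    [Module R M] (ζ : Module.End R M) {x y : M} {c : R} (h : ζ x = c • y) (n : ℕ) :
    ∑ j ∈ Finset.Icc 1 (n + 1), ((-1 : R) ^ (j + 1)) • (ζ ^ j) x =
      c • (y - ∑ j ∈ Finset.Icc 1 n, ((-1 : R) ^ (j + 1)) • (ζ ^ j) y) := by
  have hpow (j : ℕ) : (ζ ^ (j + 1)) x = c • (ζ ^ j) y := by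
    rw [pow_succ, Module.End.mul_apply, h, map_smul]
  induction n with
  | zero => simp [h]
  | succ n ih =>
    rw [Finset.sum_Icc_succ_top (by omega), ih, Finset.sum_Icc_succ_top (by omega), hpow]
    module


/-- Lemma 3.3 (the method for 𝒟-operators of type 1). -/
theorem stmt0
    (p : ℕ → ℝ[X]) (hdeg : ∀ n : ℕ, (p n).degree = n)
    (Dp : Module.End ℝ ℝ[X]) (θ : ℕ → ℝ)
    (hDp : ∀ n : ℕ, Dp (p n) = θ n • p n)
    (ε : ℕ → ℝ)
    (ζ : Module.End ℝ ℝ[X])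
    (hζ0 : ζ (p 0) = 0)
    (hζ : ∀ n : ℕ, ζ (p (n+1)) = ε (n+1) • p n)
    (𝒟 : Module.End ℝ ℝ[X])
    (h𝒟 : ∀ n : ℕ, 𝒟 (p n) = ∑ j ∈ Finset.Icc 1 n, ((-1:ℝ)^(j+1)) • (ζ^j) (p n))
    (P₂ : ℝ[X]) (hP₂ : ∀ n : ℕ, P₂.eval (θ n) ≠ 0)
    (γ : ℕ → ℝ) (hγ : ∀ n : ℕ, γ (n+1) = P₂.eval (θ n))
    (lam : ℕ → ℝ) (hlam : ∀ n : ℕ, lam (n+1) - lam n = γ (n+1))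
    (P₁ : ℝ[X]) (hP₁ : ∀ n : ℕ, lam n = P₁.eval (θ n))
    (β : ℕ → ℝ) (hβ : ∀ n : ℕ, 1 ≤ n → β n = ε n * γ (n+1) / γ n)
    (q : ℕ → ℝ[X]) (hq0 : q 0 = p 0)
    (hq : ∀ n : ℕ, q (n+1) = p (n+1) + β (n+1) • p n) :
    ∀ n : ℕ, (aeval Dp P₁ + 𝒟 * aeval Dp P₂) (q n) = lam n • q n := by
  have hne (n : ℕ) : p n ≠ 0 := by
    intro h
    simpa [h] using hdeg n
  have haeval (P : ℝ[X]) (n : ℕ) : aeval Dp P (p n) = P.eval (θ n) • p n :=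
    Module.End.aeval_apply_of_hasEigenvector
      ⟨Module.End.mem_eigenspace_iff.mpr (hDp n), hne n⟩
  rintro (_ | n)
  · simp [hq0, haeval, h𝒟, hP₁]
  · have h𝒟succ : 𝒟 (p (n + 1)) = ε (n + 1) • (p n - 𝒟 (p n)) := by
      rw [h𝒟, h𝒟, sum_alternating_pow_apply_of_apply_eq_smul ζ (hζ n)]
    have hβγ : β (n + 1) * γ (n + 1) = ε (n + 1) * γ (n + 2) := by
      rw [hβ (n + 1) (by omega), div_mul_cancel₀]
      exact hγ n ▸ hP₂ n
    simp only [hq, LinearMap.add_apply, Module.End.mul_apply, map_add, map_smul, haeval,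
      ← hP₁, ← hγ, h𝒟succ]
    match_scalars
    · ring
    · linear_combination -hβγ - β (n + 1) * hlam n
    · linear_combination hβγ
end

section
/- Let (p_n)_{n≥0} be real polynomials with deg p_n = n for every n, and let D_p be a linear endomorphism of ℝ[X] such that D_p(p_n) = θ_n·p_n for real numbers θ_n. Let (ε_n)_{n≥1} and (σ_n)_{n≥1} be real numbers, let ζ be the linear endomorphism of ℝ[X] determined by ζ(p_0) = 0 and ζ(p_n) = ε_n·p_{n−1} for n ≥ 1, and let 𝒟 be the linear endomorphism determined by 𝒟(p_n) = −(σ_{n+1}/2)·p_n + Σ_{j=1}^{n} (−1)^{j+1} σ_{n+1−j}·ζ^j(p_n). Let P₂ be a real polynomial with P₂(θ_n) ≠ 0 for every n ≥ 0, put γ_{n+1} = P₂(θ_n) for n ≥ 0, let (λ_n)_{n≥0} be real numbers with λ_n − λ_{n−1} = σ_n·γ_n for n ≥ 1, and assume there exists a polynomial P₁ with λ_{n+1} + λ_n = P₁(θ_n) for all n ≥ 0. Define β_n = ε_n·γ_{n+1}/γ_n for n ≥ 1, and polynomials q_0 = p_0 and q_n = p_n + β_n·p_{n−1} for n ≥ 1.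 Then the operator D_q = (1/2)·P₁(D_p) + 𝒟 ∘ P₂(D_p) satisfies D_q(q_n) = λ_n·q_n for all n ≥ 0. -/
open Polynomial

/-- Lemma 3.4 (the method for 𝒟-operators of type 2). -/
theorem stmt1
    (p : ℕ → ℝ[X]) (hdeg : ∀ n : ℕ, (p n).degree = n)
    (Dp : Module.End ℝ ℝ[X]) (θ : ℕ → ℝ)
    (hDp : ∀ n : ℕ, Dp (p n) = θ n • p n)
    (ε σ : ℕ → ℝ)
    (ζ : Module.End ℝ ℝ[X])
    (hζ0 : ζ (p 0) = 0)
    (hζ : ∀ n : ℕ, ζ (p (n+1)) = ε (n+1) • p n)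
    (𝒟 : Module.End ℝ ℝ[X])
    (h𝒟 : ∀ n : ℕ, 𝒟 (p n) = (-(σ (n+1) / 2)) • p n
        + ∑ j ∈ Finset.Icc 1 n, ((-1:ℝ)^(j+1) * σ (n+1-j)) • (ζ^j) (p n))
    (P₂ : ℝ[X]) (hP₂ : ∀ n : ℕ, P₂.eval (θ n) ≠ 0)
    (γ : ℕ → ℝ) (hγ : ∀ n : ℕ, γ (n+1) = P₂.eval (θ n))
    (lam : ℕ → ℝ) (hlam : ∀ n : ℕ, lam (n+1) - lam n = σ (n+1) * γ (n+1))
    (P₁ : ℝ[X]) (hP₁ : ∀ n : ℕ, lam (n+1) + lam n = P₁.eval (θ n))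
    (β : ℕ → ℝ) (hβ : ∀ n : ℕ, 1 ≤ n → β n = ε n * γ (n+1) / γ n)
    (q : ℕ → ℝ[X]) (hq0 : q 0 = p 0)
    (hq : ∀ n : ℕ, q (n+1) = p (n+1) + β (n+1) • p n) :
    ∀ n : ℕ, (((1:ℝ)/2) • aeval Dp P₁ + 𝒟 * aeval Dp P₂) (q n) = lam n • q n := by
  have haeval : ∀ (P : ℝ[X]) (n : ℕ), aeval Dp P (p n) = P.eval (θ n) • p n := fun P n =>
    Module.End.aeval_apply_of_mem_apply_eq_smul (hDp n)
  have h𝒟zero : 𝒟 (p 0) = (-(σ 1 / 2)) • p 0 := by simpa using h𝒟 0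
  have h𝒟succ : ∀ n, 𝒟 (p (n+1)) = (-(σ (n+2) / 2)) • p (n+1)
      + ε (n+1) • ((σ (n+1) / 2) • p n - 𝒟 (p n)) := fun n => by
    have hshift : ∑ j ∈ Finset.Icc 1 (n+1),
          ((-1:ℝ)^(j+1) * σ (n+1+1-j)) • (ζ^j) (p (n+1))
        = ε (n+1) • (σ (n+1) • p n
          - ∑ j ∈ Finset.Icc 1 n, ((-1:ℝ)^(j+1) * σ (n+1-j)) • (ζ^j) (p n)) := by
      rw [← Finset.Ico_add_one_right_eq_Icc, ← Finset.Ico_add_one_right_eq_Icc,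
        Finset.sum_Ico_eq_sum_range, Finset.sum_Ico_eq_sum_range]
      simp only [Nat.add_sub_cancel]
      rw [Finset.sum_range_succ', smul_sub, Finset.smul_sum, sub_eq_add_neg,
        ← Finset.sum_neg_distrib, add_comm]
      congr 1
      · simp [hζ, smul_smul, mul_comm]
      · refine Finset.sum_congr rfl fun i _ => ?_
        rw [show n + 1 + 1 - (1 + (i + 1)) = n + 1 - (1 + i) by omega,
          show 1 + (i + 1) = (1 + i) + 1 by omega, pow_succ ζ, Module.End.mul_apply, hζ, map_smul,
          smul_smul, smul_smul, ← neg_smul]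
        congr 1
        ring
    rw [h𝒟 (n+1), hshift, h𝒟 n]
    module
  have hD : ∀ n, (((1:ℝ)/2) • aeval Dp P₁ + 𝒟 * aeval Dp P₂) (p n)
      = ((lam (n+1) + lam n) / 2) • p n + γ (n+1) • 𝒟 (p n) := fun n => by
    simp only [LinearMap.add_apply, LinearMap.smul_apply, Module.End.mul_apply, haeval, map_smul,
      hP₁, hγ]
    module
  rintro (_ | n)
  · rw [hq0, hD, h𝒟zero, smul_smul, ← add_smul]
    congr 1
    linear_combination hlam 0 / 2
  · have hβγ : β (n+1) * γ (n+1) = ε (n+1) * γ (n+2) := by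
      rw [hβ (n+1) (Nat.succ_pos n), div_mul_cancel₀ _ (hγ n ▸ hP₂ n)]
    rw [hq, map_add, map_smul, hD, hD, h𝒟succ]
    match_scalars
    · linear_combination hlam (n+1) / 2
    · linear_combination -β (n+1) * hlam n / 2 - σ (n+1) / 2 * hβγ
    · linear_combination hβγ
end

section
/- Let ν : ℝ[X] → ℝ be a linear functional, let λ ∈ ℝ, and define the linear functional μ by μ(p) = ν((X−λ)·p). Let (p_n)_{n≥0} be real polynomials with deg p_n = n that are orthogonal with respect to μ, i.e. μ(p_n·X^m) = 0 for 0 ≤ m < n and μ(p_n·X^n) ≠ 0. Set α_n = ν(p_n), and let M ∈ ℝ be such that α_n + M·p_n(λ) ≠ 0 for every n ≥ 0. Define the functional ρ̃(p) = ν(p) + M·p(λ), the numbers β_n = −(α_n + M·p_n(λ))/(α_{n−1} + M·p_{n−1}(λ)) for n ≥ 1, and the polynomials q_0 = 1, q_n = p_n + β_n·p_{n−1} for n ≥ 1. Then the polynomials (q_n)_n are orthogonal with respect to ρ̃: for every n, ρ̃(q_n·r) = 0 for every polynomial r with deg r < n, and ρ̃(q_n·(X−λ)^n) ≠ 0. 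-/
open Polynomial

/-- A functional vanishing at `p * X ^ m` for all `m < n` vanishes at `p * f` whenever
`deg f < n`. -/
lemma map_mul_eq_zero_of_degree_lt (μ : ℝ[X] →ₗ[ℝ] ℝ) {p : ℝ[X]} {n : ℕ}
    (h : ∀ m < n, μ (p * X ^ m) = 0) {f : ℝ[X]} (hf : f.degree < n) : μ (p * f) = 0 := by
  rw [f.as_sum_range_C_mul_X_pow, Finset.mul_sum, map_sum]
  refine Finset.sum_eq_zero fun m _ => ?_
  rw [mul_left_comm, ← smul_eq_C_mul, map_smul]
  by_cases hm : m < n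
  · rw [h m hm, smul_zero]
  · rw [coeff_eq_zero_of_degree_lt (hf.trans_le (by exact_mod_cast not_lt.mp hm)), zero_smul]


/-- Lemma 2.1: adding a Dirac delta at `l` to the measure `ν`, where `μ = (x-l)ν`. -/
theorem stmt2
    (ν : ℝ[X] →ₗ[ℝ] ℝ) (l : ℝ)
    (μ : ℝ[X] →ₗ[ℝ] ℝ) (hμ : ∀ p : ℝ[X], μ p = ν ((X - C l) * p))
    (p : ℕ → ℝ[X]) (hdeg : ∀ n : ℕ, (p n).degree = n)
    (horth : ∀ n m : ℕ, m < n → μ (p n * X^m) = 0)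
    (hnd : ∀ n : ℕ, μ (p n * X^n) ≠ 0)
    (α : ℕ → ℝ) (hα : ∀ n : ℕ, α n = ν (p n))
    (M : ℝ) (hM : ∀ n : ℕ, α n + M * (p n).eval l ≠ 0)
    (ρ : ℝ[X] → ℝ) (hρ : ∀ f : ℝ[X], ρ f = ν f + M * f.eval l)
    (β : ℕ → ℝ)
    (hβ : ∀ n : ℕ, β (n+1) = -(α (n+1) + M * (p (n+1)).eval l) / (α n + M * (p n).eval l))
    (q : ℕ → ℝ[X]) (hq0 : q 0 = 1)
    (hq : ∀ n : ℕ, q (n+1) = p (n+1) + C (β (n+1)) * p n) :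
    ∀ n : ℕ, (∀ r : ℝ[X], r.degree < n → ρ (q n * r) = 0) ∧ ρ (q n * (X - C l)^n) ≠ 0 := by
  have hρ_smul (c : ℝ) (f : ℝ[X]) : ρ (C c * f) = c * ρ f := by
    rw [hρ, hρ, ← smul_eq_C_mul, map_smul, eval_smul]
    simp only [smul_eq_mul]
    ring
  have hρ_add (f g : ℝ[X]) : ρ (f + g) = ρ f + ρ g := by
    rw [hρ, hρ, hρ, map_add, eval_add]
    ring
  have hρ_mul (f : ℝ[X]) : ρ ((X - C l) * f) = μ f := by
    rw [hρ, hμ]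
    simp
  have hρp (n : ℕ) : ρ (p n) ≠ 0 := by
    rw [hρ, ← hα]
    exact hM n
  have hβρ (n : ℕ) : β (n + 1) = -ρ (p (n + 1)) / ρ (p n) := by
    rw [hβ, hρ, hρ, hα, hα]
  have hp (n : ℕ) {f : ℝ[X]} (hf : f.degree < n) : μ (p n * f) = 0 :=
    map_mul_eq_zero_of_degree_lt μ (horth n) hf
  have hμq (n : ℕ) {f : ℝ[X]} (hf : f.degree < (n + 1 : ℕ)) :
      μ (q (n + 1) * f) = β (n + 1) * μ (p n * f) := by
    rw [hq, add_mul, map_add, hp _ hf, zero_add, mul_assoc, ← smul_eq_C_mul, map_smul,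
      smul_eq_mul]
  have hρq (n : ℕ) : ρ (q (n + 1)) = 0 := by
    rw [hq, hρ_add, hρ_smul, hβρ, div_mul_cancel₀ _ (hρp n), add_neg_cancel]
  intro n
  cases n with
  | zero =>
    refine ⟨fun r hr => ?_, fun h => hρp 0 ?_⟩
    · have hr0 : r = 0 := by simpa using hr
      simp [hr0, hρ]
    · rw [eq_C_of_degree_le_zero (hdeg 0).le, ← mul_one (C _), hρ_smul]
      rw [hq0, pow_zero, mul_one] at h
      rw [h, mul_zero]
  | succ n =>
    refine ⟨fun r hr => ?_, ?_⟩
    · have hs : (r /ₘ (X - C l)).degree < n := by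
        by_cases hr0 : r = 0
        · simp [hr0]
        · have hlt : (r /ₘ (X - C l)).degree < r.degree :=
            degree_divByMonic_lt r _ hr0 (by simp)
          have hle : r.degree ≤ n := degree_le_of_natDegree_le (Nat.le_of_lt_succ ((natDegree_lt_iff_degree_lt hr0).mpr hr))
          exact hlt.trans_le hle
      have hs' : (r /ₘ (X - C l)).degree < (n + 1 : ℕ) :=
        hs.trans (by exact_mod_cast n.lt_succ_self)
      rw [← modByMonic_add_div r (X - C l), modByMonic_X_sub_C_eq_C_eval, mul_add,
        hρ_add, mul_comm (q _), hρ_smul, hρq, mul_left_comm, hρ_mul, hμq n hs', hp n hs]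
      ring
    · have hd : ((X - C l) ^ n).degree = (n : WithBot ℕ) := by simp
      have hlow : ((X - C l) ^ n - X ^ n).degree < (n : WithBot ℕ) := by
        rw [← hd]
        refine degree_sub_lt_left (by simp) (pow_ne_zero _ (X_sub_C_ne_zero l)) ?_
        rw [((monic_X_sub_C l).pow n).leadingCoeff, (monic_X_pow n).leadingCoeff]
      have hpn : μ (p n * (X - C l) ^ n) = μ (p n * X ^ n) := by
        rw [← sub_eq_zero, ← map_sub, ← mul_sub, hp n hlow]
      rw [pow_succ', mul_left_comm, hρ_mul,
        hμq n (hd.trans_lt (by exact_mod_cast n.lt_succ_self)), hpn, hβρ]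
      exact mul_ne_zero (div_ne_zero (neg_ne_zero.mpr (hρp _)) (hρp n)) (hnd n)
end

section
/- Let k ≥ 1 and let P₁ be a real polynomial of degree k+1; set P₂(x) = P₁(x−1) − P₁(x), a polynomial of degree k. Assume P₂(−n) ≠ 0 for all n ≥ 0. Let a ≠ 0 be real, define γ_{n+1} = P₂(−n) for n ≥ 0, λ_n = P₁(−n) for n ≥ 0, β_n = γ_{n+1}/γ_n for n ≥ 1, and the polynomials q_0 = 1 and q_n(x) = c_n^a(x) + β_n·c_{n−1}^a(x) for n ≥ 1. Let D = P₁(D_a) + ∇ ∘ P₂(D_a). Then D(q_n) = λ_n·q_n for all n ≥ 0. Moreover, there exist polynomials f_{−k−1}, f_{−k}, …, f_{k+1} with f_{−k−1} ≠ 0 and f_{k+1} ≠ 0 such that (Dp)(x) = Σ_{l=−k−1}^{k+1} f_l(x)·p(x+l) for every polynomial p (so D is a difference operator of order 2k+2 and genre (−k−1, k+1)). -/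
open Polynomial

/-- The Charlier polynomial `c_n^a(x) = (1/n!) ∑_{j=0}^n (-a)^{n-j} C(n,j) x(x-1)⋯(x-j+1)`. -/
noncomputable def charlier (a : ℝ) (n : ℕ) : ℝ[X] :=
  C ((n.factorial : ℝ))⁻¹ * ∑ j ∈ Finset.range (n+1),
    C ((-a)^(n-j) * (n.choose j : ℝ)) * ∏ i ∈ Finset.range j, (X - C (i : ℝ))

/-- The Newton basis polynomial `x(x-1)⋯(x-j+1) / j!`. -/
noncomputable def newtonPoly (j : ℕ) : ℝ[X] :=
  C ((j.factorial : ℝ))⁻¹ * ∏ i ∈ Finset.range j, (X - C (i : ℝ))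

lemma succ_mul_eval_newtonPoly_succ (j : ℕ) (x : ℝ) :
    (j + 1) * (newtonPoly (j + 1)).eval x = (x - j) * (newtonPoly j).eval x := by
  have : (j.factorial : ℝ) ≠ 0 := by positivity
  have : (j : ℝ) + 1 ≠ 0 := by positivity
  simp only [newtonPoly, eval_mul, eval_C, Finset.prod_range_succ, Nat.factorial_succ,
    Nat.cast_mul, Nat.cast_succ, eval_sub, eval_X]
  field_simp

lemma succ_mul_eval_newtonPoly_succ' (j : ℕ) (x : ℝ) :
    (j + 1) * (newtonPoly (j + 1)).eval x = x * (newtonPoly j).eval (x - 1) := by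
  have : (j.factorial : ℝ) ≠ 0 := by positivity
  have : (j : ℝ) + 1 ≠ 0 := by positivity
  simp only [newtonPoly, eval_mul, eval_C, Finset.prod_range_succ', Nat.factorial_succ,
    Nat.cast_mul, Nat.cast_succ, eval_sub, eval_X, eval_prod, Nat.cast_zero, sub_zero]
  have h : ∀ i : ℕ, x - ((i : ℝ) + 1) = x - 1 - i := fun i => by ring
  simp only [h]
  field_simp

lemma eval_newtonPoly_succ_sub (j : ℕ) (x : ℝ) :
    (newtonPoly (j + 1)).eval x - (newtonPoly (j + 1)).eval (x - 1)
      = (newtonPoly j).eval (x - 1) := by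
  have h1 := succ_mul_eval_newtonPoly_succ' j x
  have h2 := succ_mul_eval_newtonPoly_succ j (x - 1)
  have : (j : ℝ) + 1 ≠ 0 := by positivity
  apply mul_left_cancel₀ this
  linear_combination h1 - h2

lemma newtonPoly_zero : newtonPoly 0 = 1 := by simp [newtonPoly]

lemma charlier_eq_sum_antidiagonal (a : ℝ) (n : ℕ) :
    charlier a n = ∑ p ∈ Finset.HasAntidiagonal.antidiagonal n,
      ((-a) ^ p.1 / (p.1.factorial : ℝ)) • newtonPoly p.2 := by
  rw [charlier, ← Finset.Nat.sum_antidiagonal_swap,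
    Finset.Nat.sum_antidiagonal_eq_sum_range_succ_mk, Finset.mul_sum]
  refine Finset.sum_congr rfl fun j hj => ?_
  have hj : j ≤ n := Nat.lt_succ_iff.mp (Finset.mem_range.mp hj)
  simp only [Prod.swap, newtonPoly, smul_eq_C_mul, ← mul_assoc, ← C_mul]
  rw [Nat.cast_choose ℝ hj]
  congr 2
  have : (n.factorial : ℝ) ≠ 0 := by positivity
  field_simp

lemma charlier_zero (a : ℝ) : charlier a 0 = 1 := by simp [charlier]

section Operators

variable {a : ℝ} {Da nab : Module.End ℝ ℝ[X]}

lemma charlierOp_newtonPoly_zero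
    (hDa : ∀ f : ℝ[X], ∀ x : ℝ,
      (Da f).eval x = x * f.eval (x-1) - (x+a) * f.eval x + a * f.eval (x+1)) :
    Da (newtonPoly 0) = 0 := by
  refine Polynomial.funext fun x => ?_
  simp only [hDa, newtonPoly_zero, eval_one, eval_zero]
  ring

lemma charlierOp_newtonPoly_succ
    (hDa : ∀ f : ℝ[X], ∀ x : ℝ,
      (Da f).eval x = x * f.eval (x-1) - (x+a) * f.eval x + a * f.eval (x+1)) (j : ℕ) :
    Da (newtonPoly (j + 1)) = (-((j + 1 : ℕ) : ℝ)) • newtonPoly (j + 1) + a • newtonPoly j := by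
  refine Polynomial.funext fun x => ?_
  have h1 := succ_mul_eval_newtonPoly_succ' (j + 1) x
  have h2 := succ_mul_eval_newtonPoly_succ (j + 1) x
  have h3 := eval_newtonPoly_succ_sub j (x + 1)
  rw [add_sub_cancel_right] at h3
  simp only [hDa, eval_add, eval_smul, smul_eq_mul]
  push_cast at *
  linear_combination h2 - h1 + a * h3

lemma charlierOp_charlier
    (hDa : ∀ f : ℝ[X], ∀ x : ℝ,
      (Da f).eval x = x * f.eval (x-1) - (x+a) * f.eval x + a * f.eval (x+1)) (n : ℕ) :
    Da (charlier a n) = (-(n : ℝ)) • charlier a n := by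
  rcases n with _ | n
  · have := charlierOp_newtonPoly_zero hDa
    rw [newtonPoly_zero] at this
    simp [charlier_zero, this]
  set u : ℕ → ℝ := fun i => (-a) ^ i / (i.factorial : ℝ) with hu
  have hstep : ∀ i, a * u i = -((i + 1 : ℕ) : ℝ) * u (i + 1) := fun i => by
    have : (i.factorial : ℝ) ≠ 0 := by positivity
    have : (i : ℝ) + 1 ≠ 0 := by positivity
    simp only [hu, Nat.factorial_succ, Nat.cast_mul, Nat.cast_succ]
    field_simp
    ring
  have hc : charlier a (n + 1) = ∑ p ∈ Finset.HasAntidiagonal.antidiagonal (n + 1), u p.1 • newtonPoly p.2 :=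
    charlier_eq_sum_antidiagonal a (n + 1)
  have hlow : ∑ p ∈ Finset.HasAntidiagonal.antidiagonal n, (a * u p.1) • newtonPoly p.2
      = ∑ p ∈ Finset.HasAntidiagonal.antidiagonal (n + 1), (-(p.1 : ℝ) * u p.1) • newtonPoly p.2 := by
    rw [Finset.Nat.sum_antidiagonal_succ]
    simp [hstep]
  have hdiag : ∑ p ∈ Finset.HasAntidiagonal.antidiagonal (n + 1), u p.1 • Da (newtonPoly p.2)
      = ∑ p ∈ Finset.HasAntidiagonal.antidiagonal (n + 1), (-(p.2 : ℝ) * u p.1) • newtonPoly p.2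
        + ∑ p ∈ Finset.HasAntidiagonal.antidiagonal n, (a * u p.1) • newtonPoly p.2 := by
    rw [Finset.Nat.sum_antidiagonal_succ', Finset.Nat.sum_antidiagonal_succ']
    simp only [charlierOp_newtonPoly_zero hDa, charlierOp_newtonPoly_succ hDa, smul_add,
      Finset.sum_add_distrib, smul_smul, smul_zero, Nat.cast_zero, neg_zero, mul_zero, zero_smul,
      zero_add, mul_comm]
  rw [hc, map_sum]
  simp only [map_smul]
  rw [hdiag, hlow, ← Finset.sum_add_distrib, Finset.smul_sum]
  refine Finset.sum_congr rfl fun p hp => ?_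
  rw [← add_smul, smul_smul, ← Finset.HasAntidiagonal.mem_antidiagonal.mp hp]
  push_cast
  congr 1
  ring

lemma aeval_charlierOp_charlier
    (hDa : ∀ f : ℝ[X], ∀ x : ℝ,
      (Da f).eval x = x * f.eval (x-1) - (x+a) * f.eval x + a * f.eval (x+1))
    (P : ℝ[X]) (n : ℕ) :
    aeval Da P (charlier a n) = P.eval (-(n : ℝ)) • charlier a n := by
  have h : ∀ i : ℕ, (Da ^ i) (charlier a n) = (-(n : ℝ)) ^ i • charlier a n := fun i => by
    induction i with
    | zero => simp
    | succ i ih =>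
      rw [pow_succ', Module.End.mul_apply, ih, map_smul, charlierOp_charlier hDa, smul_smul,
        pow_succ]
  rw [aeval_eq_sum_range, eval_eq_sum_range, LinearMap.sum_apply, Finset.sum_smul]
  simp only [LinearMap.smul_apply, h, smul_smul]

lemma backwardDiff_newtonPoly_add
    (hnab : ∀ f : ℝ[X], ∀ x : ℝ, (nab f).eval x = f.eval x - f.eval (x-1)) (j : ℕ) :
    nab (newtonPoly (j + 1)) + nab (newtonPoly j) = newtonPoly j := by
  refine Polynomial.funext fun x => ?_
  simp only [eval_add, hnab, eval_newtonPoly_succ_sub]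
  ring

lemma backwardDiff_charlier_add
    (hnab : ∀ f : ℝ[X], ∀ x : ℝ, (nab f).eval x = f.eval x - f.eval (x-1)) (n : ℕ) :
    nab (charlier a (n + 1)) + nab (charlier a n) = charlier a n := by
  have h0 : nab (newtonPoly 0) = 0 := by
    refine Polynomial.funext fun x => ?_
    simp [hnab, newtonPoly_zero]
  simp only [charlier_eq_sum_antidiagonal, map_sum, map_smul]
  rw [Finset.Nat.sum_antidiagonal_succ']
  simp only [h0, smul_zero, zero_add]
  rw [← Finset.sum_add_distrib]
  simp only [← smul_add, backwardDiff_newtonPoly_add hnab]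

/-- `T` is the (possibly infinite) difference operator `p ↦ ∑ l, f l * p(x + l)`. -/
def HasShiftCoeffs (T : Module.End ℝ ℝ[X]) (f : ℤ → ℝ[X]) : Prop :=
  ∀ (p : ℝ[X]) (x : ℝ), HasSum (fun l : ℤ => (f l).eval x * p.eval (x + l)) ((T p).eval x)

lemma hasShiftCoeffs_one : HasShiftCoeffs 1 (Pi.single 0 1) := fun p x => by
  convert hasSum_single (0 : ℤ) ?_ using 1
  · simp
  · intro l hl
    simp [Pi.single_eq_of_ne hl]

lemma HasShiftCoeffs.add {S T : Module.End ℝ ℝ[X]} {f g : ℤ → ℝ[X]}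
    (hS : HasShiftCoeffs S f) (hT : HasShiftCoeffs T g) :
    HasShiftCoeffs (S + T) (fun l => f l + g l) := fun p x => by
  simpa [add_mul] using (hS p x).add (hT p x)

/-- Evaluating `T p` at `x + s` shifts the index of the coefficients by `s`. -/
lemma HasShiftCoeffs.shift {T : Module.End ℝ ℝ[X]} {f : ℤ → ℝ[X]} (hT : HasShiftCoeffs T f)
    (s : ℤ) (p : ℝ[X]) (x : ℝ) :
    HasSum (fun l : ℤ => (f (l - s)).eval (x + s) * p.eval (x + l)) ((T p).eval (x + s)) := by
  rw [← (Equiv.addRight s).hasSum_iff]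
  convert hT p (x + s) using 2 with l
  simp only [Function.comp, Equiv.coe_addRight, add_sub_cancel_right]
  push_cast
  ring_nf

lemma HasShiftCoeffs.charlierOp_mul
    (hDa : ∀ f : ℝ[X], ∀ x : ℝ,
      (Da f).eval x = x * f.eval (x-1) - (x+a) * f.eval x + a * f.eval (x+1))
    {T : Module.End ℝ ℝ[X]} {f : ℤ → ℝ[X]} (hT : HasShiftCoeffs T f) :
    HasShiftCoeffs (Da * T) (fun l => X * (f (l + 1)).comp (X - C 1) - (X + C a) * f l
      + C a * (f (l - 1)).comp (X + C 1)) := fun p x => by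
  have h1 := (hT.shift (-1) p x).mul_left x
  have h2 := (hT p x).mul_left (x + a)
  have h3 := (hT.shift 1 p x).mul_left a
  convert (h1.sub h2).add h3 using 1
  · rfl
  · funext l
    simp [eval_comp, ← sub_eq_add_neg]
    ring
  · simp [hDa, ← sub_eq_add_neg]

lemma HasShiftCoeffs.backwardDiff_mul
    (hnab : ∀ f : ℝ[X], ∀ x : ℝ, (nab f).eval x = f.eval x - f.eval (x-1))
    {T : Module.End ℝ ℝ[X]} {f : ℤ → ℝ[X]} (hT : HasShiftCoeffs T f) :
    HasShiftCoeffs (nab * T) (fun l => f l - (f (l + 1)).comp (X - C 1)) := fun p x => by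
  convert (hT p x).sub (hT.shift (-1) p x) using 1
  · rfl
  · funext l
    simp [eval_comp, ← sub_eq_add_neg]
    ring
  · simp [hnab, ← sub_eq_add_neg]

/-- The shift coefficients of the `i`-th power of the Charlier operator. -/
noncomputable def charlierPowCoeff (a : ℝ) : ℕ → ℤ → ℝ[X]
  | 0, l => (Pi.single 0 1 : ℤ → ℝ[X]) l
  | i + 1, l => X * (charlierPowCoeff a i (l + 1)).comp (X - C 1)
      - (X + C a) * charlierPowCoeff a i l + C a * (charlierPowCoeff a i (l - 1)).comp (X + C 1)

lemma charlierPowCoeff_eq_zero (a : ℝ) (i : ℕ) (l : ℤ) (hl : (i : ℤ) < |l|) :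
    charlierPowCoeff a i l = 0 := by
  induction i generalizing l with
  | zero =>
    rw [charlierPowCoeff, Pi.single_eq_of_ne]
    rintro rfl
    simp at hl
  | succ i ih =>
    push_cast at hl
    rw [lt_abs] at hl
    rw [charlierPowCoeff, ih (l + 1) (by rw [lt_abs]; omega), ih l (by rw [lt_abs]; omega),
      ih (l - 1) (by rw [lt_abs]; omega)]
    simp

lemma charlierPowCoeff_self (a : ℝ) (i : ℕ) : charlierPowCoeff a i i = C (a ^ i) := by
  induction i with
  | zero => simp [charlierPowCoeff]
  | succ i ih =>
    push_cast
    rw [charlierPowCoeff, charlierPowCoeff_eq_zero a i _ (by rw [lt_abs]; omega),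
      charlierPowCoeff_eq_zero a i (i + 1) (by rw [lt_abs]; omega), add_sub_cancel_right, ih,
      pow_succ']
    simp

lemma charlierPowCoeff_succ_neg (a : ℝ) (i : ℕ) :
    charlierPowCoeff a (i + 1) (-(i + 1)) = X * (charlierPowCoeff a i (-i)).comp (X - C 1) := by
  rw [charlierPowCoeff, charlierPowCoeff_eq_zero a i (-(i + 1)) (by rw [lt_abs]; omega),
    charlierPowCoeff_eq_zero a i (-(i + 1) - 1) (by rw [lt_abs]; omega),
    show (-((i : ℤ) + 1) + 1) = -i by ring]
  simp

lemma monic_charlierPowCoeff_neg (a : ℝ) (i : ℕ) : (charlierPowCoeff a i (-i)).Monic := by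
  induction i with
  | zero => simp [charlierPowCoeff]
  | succ i ih =>
    push_cast
    rw [charlierPowCoeff_succ_neg]
    exact monic_X.mul (ih.comp_X_sub_C 1)

lemma hasShiftCoeffs_charlierOp_pow
    (hDa : ∀ f : ℝ[X], ∀ x : ℝ,
      (Da f).eval x = x * f.eval (x-1) - (x+a) * f.eval x + a * f.eval (x+1)) (i : ℕ) :
    HasShiftCoeffs (Da ^ i) (charlierPowCoeff a i) := by
  induction i with
  | zero => exact hasShiftCoeffs_one
  | succ i ih =>
    rw [pow_succ']
    exact ih.charlierOp_mul hDa

/-- The shift coefficients of `∑ i ≤ n, Pᵢ Dᵢ`, for the Charlier operator `D`. -/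
noncomputable def charlierAevalCoeff (a : ℝ) (P : ℝ[X]) (n : ℕ) (l : ℤ) : ℝ[X] :=
  ∑ i ∈ Finset.range (n + 1), C (P.coeff i) * charlierPowCoeff a i l

lemma hasShiftCoeffs_aeval_charlierOp
    (hDa : ∀ f : ℝ[X], ∀ x : ℝ,
      (Da f).eval x = x * f.eval (x-1) - (x+a) * f.eval x + a * f.eval (x+1))
    (P : ℝ[X]) (n : ℕ) (hP : P.natDegree ≤ n) :
    HasShiftCoeffs (aeval Da P) (charlierAevalCoeff a P n) := fun p x => by
  have h := hasSum_sum (s := Finset.range (n + 1)) fun i _ =>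
    (hasShiftCoeffs_charlierOp_pow hDa i p x).mul_left (P.coeff i)
  convert h using 1
  · rfl
  · funext l
    simp [charlierAevalCoeff, eval_finsetSum, Finset.sum_mul, mul_assoc]
  · simp [aeval_eq_sum_range' (Nat.lt_succ_of_le hP), eval_finsetSum]

lemma charlierAevalCoeff_eq_zero (a : ℝ) (P : ℝ[X]) (n : ℕ) (l : ℤ) (hl : (n : ℤ) < |l|) :
    charlierAevalCoeff a P n l = 0 := by
  refine Finset.sum_eq_zero fun i hi => ?_
  have := Finset.mem_range.mp hi
  rw [charlierPowCoeff_eq_zero a i l (by omega), mul_zero]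

lemma charlierAevalCoeff_of_abs_eq (a : ℝ) (P : ℝ[X]) (n : ℕ) (l : ℤ) (hl : |l| = n) :
    charlierAevalCoeff a P n l = C (P.coeff n) * charlierPowCoeff a n l := by
  rw [charlierAevalCoeff, Finset.sum_range_succ, Finset.sum_eq_zero, zero_add]
  intro i hi
  have := Finset.mem_range.mp hi
  rw [charlierPowCoeff_eq_zero a i l (by omega), mul_zero]

end Operators

/-- The backward difference lowers the degree. -/
lemma natDegree_comp_X_sub_one_sub_le (P : ℝ[X]) (k : ℕ) (hP : P.degree = (k + 1 : ℕ)) :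
    (P.comp (X - 1) - P).natDegree ≤ k := by
  have hnat : P.natDegree = k + 1 := natDegree_eq_of_degree_eq_some hP
  have hP0 : P ≠ 0 := by
    rintro rfl
    simp at hnat
  have h1 : (X - 1 : ℝ[X]) = X - C 1 := by simp
  have hX : (X - C 1 : ℝ[X]).natDegree = 1 := natDegree_X_sub_C 1
  have hdeg : (P.comp (X - 1)).natDegree = P.natDegree := by
    rw [h1, natDegree_comp, hX, mul_one]
  have hlead : (P.comp (X - 1)).leadingCoeff = P.leadingCoeff := by
    rw [h1, leadingCoeff_comp (by rw [hX]; exact one_ne_zero), leadingCoeff_X_sub_C, one_pow,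
      mul_one]
  have hne : P.comp (X - 1) ≠ 0 := by
    rw [← leadingCoeff_ne_zero, hlead]
    exact leadingCoeff_ne_zero.mpr hP0
  have hlt := degree_sub_lt_left
    (by rw [degree_eq_natDegree hne, degree_eq_natDegree hP0, hdeg]) hne hlead
  rw [degree_eq_natDegree hne, hdeg, hnat] at hlt
  rw [natDegree_le_iff_coeff_eq_zero]
  exact fun N hN => coeff_eq_zero_of_degree_lt (hlt.trans_le (by exact_mod_cast hN))

/-- Theorem 1.1 (Charlier case): the polynomials `q_n = c_n^a + β_n c_{n-1}^a` are
eigenfunctions of the difference operator `D = P₁(D_a) + ∇ P₂(D_a)` of order `2k+2`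
and genre `(-k-1, k+1)`. -/
theorem stmt5 (k : ℕ) (hk : 1 ≤ k)
    (P₁ P₂ : ℝ[X]) (hdegP₁ : P₁.degree = (k+1 : ℕ))
    (hP₂ : P₂ = P₁.comp (X - 1) - P₁)
    (hnz : ∀ n : ℕ, P₂.eval (-(n : ℝ)) ≠ 0)
    (a : ℝ) (ha : a ≠ 0)
    (γ lam β : ℕ → ℝ)
    (hγ : ∀ n : ℕ, γ (n+1) = P₂.eval (-(n : ℝ)))
    (hlam : ∀ n : ℕ, lam n = P₁.eval (-(n : ℝ)))
    (hβ : ∀ n : ℕ, 1 ≤ n → β n = γ (n+1) / γ n)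
    (q : ℕ → ℝ[X]) (hq0 : q 0 = 1)
    (hq : ∀ n : ℕ, q (n+1) = charlier a (n+1) + C (β (n+1)) * charlier a n)
    (Da : Module.End ℝ ℝ[X])
    (hDa : ∀ f : ℝ[X], ∀ x : ℝ,
      (Da f).eval x = x * f.eval (x-1) - (x+a) * f.eval x + a * f.eval (x+1))
    (nab : Module.End ℝ ℝ[X])
    (hnab : ∀ f : ℝ[X], ∀ x : ℝ, (nab f).eval x = f.eval x - f.eval (x-1))
    (D : Module.End ℝ ℝ[X])
    (hD : D = aeval Da P₁ + nab * aeval Da P₂) :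
    (∀ n : ℕ, D (q n) = lam n • q n) ∧
    (∃ f : ℤ → ℝ[X], f (-(k+1 : ℤ)) ≠ 0 ∧ f (k+1 : ℤ) ≠ 0 ∧
      ∀ p : ℝ[X], ∀ x : ℝ,
        (D p).eval x = ∑ l ∈ Finset.Icc (-(k+1 : ℤ)) (k+1 : ℤ),
          (f l).eval x * p.eval (x + (l : ℝ))) := by
  have hdegP₂ : P₂.natDegree ≤ k := hP₂ ▸ natDegree_comp_X_sub_one_sub_le P₁ k hdegP₁
  have hnat : P₁.natDegree = k + 1 := natDegree_eq_of_degree_eq_some hdegP₁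
  have hcoeff : P₁.coeff (k + 1) ≠ 0 := coeff_ne_zero_of_eq_degree hdegP₁
  refine ⟨fun n => ?_, ?_⟩
  · rcases n with _ | n
    · have h1 := aeval_charlierOp_charlier hDa P₁ 0
      have h2 := aeval_charlierOp_charlier hDa P₂ 0
      have h3 : nab 1 = 0 := Polynomial.funext fun x => by simp [hnab]
      rw [charlier_zero] at h1 h2
      rw [hD, hq0, LinearMap.add_apply, Module.End.mul_apply, h1, h2, map_smul, h3, hlam,
        smul_zero, add_zero]
    · have hγ0 : γ (n + 1) ≠ 0 := by
        rw [hγ]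
        exact hnz n
      have hβγ : β (n + 1) * γ (n + 1) = γ (n + 2) := by
        rw [hβ (n + 1) (by omega)]
        field_simp
      have hγlam : γ (n + 1) = lam (n + 1) - lam n := by
        rw [hγ, hlam, hlam, hP₂]
        simp only [eval_sub, eval_comp, eval_X, eval_one]
        push_cast
        ring_nf
      have hsum := backwardDiff_charlier_add (a := a) hnab n
      rw [hD, hq, ← smul_eq_C_mul]
      simp only [LinearMap.add_apply, Module.End.mul_apply, map_add, map_smul,
        aeval_charlierOp_charlier hDa, ← hlam, ← hγ]
      rw [eq_sub_of_add_eq hsum, ← hβγ, hγlam]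
      module
  · have hrep : HasShiftCoeffs D _ := hD ▸
      (hasShiftCoeffs_aeval_charlierOp hDa P₁ (k + 1) hnat.le).add
        ((hasShiftCoeffs_aeval_charlierOp hDa P₂ k hdegP₂).backwardDiff_mul hnab)
    refine ⟨_, ?_, ?_, fun p x => (hrep p x).unique (hasSum_sum_of_ne_finset_zero ?_)⟩
    · rw [charlierAevalCoeff_of_abs_eq a P₁ (k + 1) _ (by rw [abs_neg, abs_of_nonneg] <;> omega),
        charlierAevalCoeff_eq_zero a P₂ k _ (by rw [lt_abs]; omega),
        charlierAevalCoeff_of_abs_eq a P₂ k _ (by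
          rw [show (-((k : ℤ) + 1) + 1) = -k by ring, abs_neg, abs_of_nonneg]; omega),
        charlierPowCoeff_succ_neg, show (-((k : ℤ) + 1) + 1) = -k by ring, mul_comp, C_comp,
        zero_sub, ← sub_eq_add_neg, ← mul_assoc, ← sub_mul]
      refine mul_ne_zero (fun h => hcoeff ?_)
        ((monic_charlierPowCoeff_neg a k).comp_X_sub_C 1).ne_zero
      simpa [coeff_C] using congrArg (fun f => coeff f 1) h
    · have htop := charlierPowCoeff_self a (k + 1)
      push_cast at htop
      rw [charlierAevalCoeff_of_abs_eq a P₁ (k + 1) _ (by rw [abs_of_nonneg] <;> omega),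
        charlierAevalCoeff_eq_zero a P₂ k _ (by rw [lt_abs]; omega),
        charlierAevalCoeff_eq_zero a P₂ k _ (by rw [lt_abs]; omega), htop]
      simp [hcoeff, ha]
    · intro l hl
      rw [Finset.mem_Icc] at hl
      rw [charlierAevalCoeff_eq_zero a P₁ (k + 1) l (by rw [lt_abs]; omega),
        charlierAevalCoeff_eq_zero a P₂ k l (by rw [lt_abs]; omega),
        charlierAevalCoeff_eq_zero a P₂ k (l + 1) (by rw [lt_abs]; omega)]
      simp
end

section
/- For every integer k ≥ 1, every real number a ≠ 0, and every n ≥ 0, one has (−1)^k·k!·c_n^a(−k−1) + Σ_{x=0}^{∞} [a^{x+k+1} / ((x+k+1)·x!)] · c_n^a(x) = (−1)^n · e^a · k! · c_k^{−a}(−n−1), where the series converges absolutely and e^a denotes the real exponential of a. -/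
open Polynomial

theorem HasSum.of_forall_eq {f g : ℕ → ℝ} {b c : ℝ} (h : HasSum f b) (hf : ∀ x, g x = f x)
    (hb : c = b) : HasSum g c := by
  rwa [funext hf, hb]

theorem charlier_eval (a : ℝ) (n : ℕ) (x : ℝ) :
    (charlier a n).eval x = ((n.factorial : ℝ))⁻¹ * ∑ j ∈ Finset.range (n + 1),
      ((-a) ^ (n - j) * (n.choose j : ℝ)) * ∏ i ∈ Finset.range j, (x - (i : ℝ)) := by
  simp [charlier, eval_finsetSum, eval_prod]

theorem prod_range_add_sub_mul_factorial (y j : ℕ) :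
    (∏ i ∈ Finset.range j, (((y + j : ℕ) : ℝ) - (i : ℝ))) * y.factorial =
      ((y + j).factorial : ℝ) := by
  induction j with
  | zero => simp
  | succ j ih =>
    rw [Finset.prod_range_succ', ← add_assoc, Nat.factorial_succ]
    push_cast at ih ⊢
    rw [← ih]
    simp only [add_sub_add_right_eq_sub, sub_zero]
    ring

theorem prod_range_neg_sub_mul_factorial (k j : ℕ) :
    (k.factorial : ℝ) * (∏ i ∈ Finset.range j, (-(k : ℝ) - 1 - (i : ℝ))) =
      (-1) ^ j * ((k + j).factorial : ℝ) := by
  induction j with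
  | zero => simp
  | succ j ih =>
    rw [Finset.prod_range_succ, ← mul_assoc, ih, ← add_assoc, Nat.factorial_succ]
    push_cast
    ring

/-- The linear functional `X ^ m ↦ m!`, that is, `p ↦ ∫ s in (0, ∞), p(s) e^{-s}`. -/
noncomputable def factorialFunctional : ℝ[X] →ₗ[ℝ] ℝ :=
  Polynomial.lsum fun m => (m.factorial : ℝ) • LinearMap.id

theorem factorialFunctional_monomial (m : ℕ) (c : ℝ) :
    factorialFunctional (monomial m c) = c * m.factorial := by
  simp [factorialFunctional, Polynomial.lsum_apply, mul_comm]

theorem factorialFunctional_eq_eval_add_derivative (p : ℝ[X]) :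
    factorialFunctional p = p.eval 0 + factorialFunctional (derivative p) := by
  induction p using Polynomial.induction_on' with
  | add p q hp hq => simp only [map_add, eval_add, hp, hq]; ring
  | monomial m c =>
    rw [derivative_monomial, factorialFunctional_monomial, factorialFunctional_monomial]
    cases m with
    | zero => simp
    | succ m => simp [Nat.factorial_succ]; ring

theorem factorialFunctional_sub_X_pow_succ (a : ℝ) (m : ℕ) :
    factorialFunctional ((C a - X) ^ (m + 1)) =
      a ^ (m + 1) - (m + 1) * factorialFunctional ((C a - X) ^ m) := by
  have h : derivative ((C a - X) ^ (m + 1)) = -(((m : ℝ) + 1) • (C a - X) ^ m) := by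
    rw [derivative_pow, smul_eq_C_mul]
    simp
  rw [factorialFunctional_eq_eval_add_derivative, h, map_neg, map_smul]
  simp [sub_eq_add_neg]

/-- Power series expansion of `∫ t in 0..a, t ^ m * exp t`. -/
theorem hasSum_pow_div_mul_factorial (a : ℝ) (m : ℕ) :
    HasSum (fun x : ℕ => a ^ (x + m + 1) / (((x : ℝ) + m + 1) * x.factorial))
      (Real.exp a * factorialFunctional ((C a - X) ^ m) - (-1) ^ m * m.factorial) := by
  have hexp : HasSum (fun x : ℕ => a ^ x / (x.factorial : ℝ)) (Real.exp a) := by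
    rw [Real.exp_eq_exp_ℝ]
    exact NormedSpace.expSeries_div_hasSum_exp a
  induction m with
  | zero =>
    have h := (hasSum_nat_add_iff' 1).2 hexp
    have h1 : factorialFunctional 1 = 1 := by
      simpa using factorialFunctional_monomial 0 1
    refine h.of_forall_eq (fun x => ?_) ?_
    · simp [Nat.factorial_succ]
    · simp [h1]
  | succ m ih =>
    have h := (hasSum_nat_add_iff' 1).2 ((hexp.mul_left (a ^ (m + 1))).sub
      (ih.mul_left ((m : ℝ) + 1)))
    refine h.of_forall_eq (fun x => ?_) ?_
    · rw [Nat.factorial_succ]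
      push_cast
      field_simp
      ring
    · rw [factorialFunctional_sub_X_pow_succ, Nat.factorial_succ]
      simp
      field_simp
      ring

theorem hasSum_pow_div_mul_prod (a : ℝ) (k j : ℕ) :
    HasSum (fun x : ℕ => a ^ (x + k + 1) / (((x : ℝ) + k + 1) * x.factorial) *
        ∏ i ∈ Finset.range j, ((x : ℝ) - (i : ℝ)))
      (Real.exp a * factorialFunctional ((C a - X) ^ (k + j)) -
        (-1) ^ (k + j) * (k + j).factorial) := by
  rw [← hasSum_nat_add_iff' j, Finset.sum_eq_zero, sub_zero]
  · refine (hasSum_pow_div_mul_factorial a (k + j)).of_forall_eq (fun y => ?_) rfl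
    have hP : (∏ i ∈ Finset.range j, (((y + j : ℕ) : ℝ) - (i : ℝ))) ≠ 0 := fun h => by
      have := prod_range_add_sub_mul_factorial y j
      rw [h, zero_mul] at this
      exact Nat.factorial_ne_zero (y + j) (by exact_mod_cast this.symm)
    rw [← prod_range_add_sub_mul_factorial y j]
    generalize (∏ i ∈ Finset.range j, (((y + j : ℕ) : ℝ) - (i : ℝ))) = P at hP ⊢
    push_cast
    field_simp
    ring
  · intro x hx
    rw [Finset.prod_eq_zero hx (sub_self _), mul_zero]

theorem sum_choose_mul_factorialFunctional (a : ℝ) (k n : ℕ) :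
    ∑ j ∈ Finset.range (n + 1), ((-a) ^ (n - j) * (n.choose j : ℝ)) *
        factorialFunctional ((C a - X) ^ (k + j)) =
      (-1) ^ n * ∑ i ∈ Finset.range (k + 1), (a ^ (k - i) * (k.choose i : ℝ)) *
        ((-1) ^ i * ((n + i).factorial : ℝ)) := by
  have hl : ∑ j ∈ Finset.range (n + 1), ((-a) ^ (n - j) * (n.choose j : ℝ)) •
      (C a - X) ^ (k + j) = (C a - X) ^ k * (-X) ^ n := by
    rw [show (-X : ℝ[X]) = (C a - X) + C (-a) by rw [C_neg]; ring, add_pow, Finset.mul_sum]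
    refine Finset.sum_congr rfl fun j _ => ?_
    rw [smul_eq_C_mul, C_mul, C_pow, C_eq_natCast]
    ring
  have hr : (C a - X) ^ k * (-X) ^ n = ∑ i ∈ Finset.range (k + 1),
      monomial (n + i) ((-1) ^ n * (a ^ (k - i) * (k.choose i : ℝ) * (-1) ^ i)) := by
    rw [show (C a - X : ℝ[X]) = -X + C a by ring, add_pow, Finset.sum_mul]
    refine Finset.sum_congr rfl fun i _ => ?_
    rw [← C_mul_X_pow_eq_monomial, neg_pow (X : ℝ[X]) i, neg_pow (X : ℝ[X]) n]
    simp only [C_mul, C_pow, C_neg, C_1, C_eq_natCast]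
    ring
  have h := congrArg factorialFunctional (hl.trans hr)
  simp only [map_sum, map_smul, smul_eq_mul, factorialFunctional_monomial] at h
  rw [h, Finset.mul_sum]
  exact Finset.sum_congr rfl fun i _ => by ring

theorem hasSum_charlier (k : ℕ) (a : ℝ) (n : ℕ) :
    HasSum (fun x : ℕ =>
        a ^ (x + k + 1) / (((x : ℝ) + k + 1) * x.factorial) * (charlier a n).eval (x : ℝ))
      ((-1 : ℝ) ^ n * Real.exp a * k.factorial * (charlier (-a) k).eval (-(n : ℝ) - 1) -
        (-1 : ℝ) ^ k * k.factorial * (charlier a n).eval (-(k : ℝ) - 1)) := by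
  have h := (hasSum_sum fun j (_ : j ∈ Finset.range (n + 1)) =>
    (hasSum_pow_div_mul_prod a k j).mul_left ((-a) ^ (n - j) * (n.choose j : ℝ))).mul_left
      ((n.factorial : ℝ))⁻¹
  have hk : (k.factorial : ℝ) ≠ 0 := by positivity
  have hn : (n.factorial : ℝ) ≠ 0 := by positivity
  refine h.of_forall_eq (fun x => ?_) ?_
  · rw [charlier_eval, mul_left_comm, Finset.mul_sum]
    congr 1
    exact Finset.sum_congr rfl fun j _ => by ring
  · have hlhs : (k.factorial : ℝ) * (charlier a n).eval (-(k : ℝ) - 1) =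
        (n.factorial : ℝ)⁻¹ * ∑ j ∈ Finset.range (n + 1),
          ((-a) ^ (n - j) * (n.choose j : ℝ)) * ((-1) ^ j * ((k + j).factorial : ℝ)) := by
      rw [charlier_eval, mul_left_comm, Finset.mul_sum]
      congr 1
      refine Finset.sum_congr rfl fun j _ => ?_
      rw [← prod_range_neg_sub_mul_factorial]
      ring
    have hrhs : (k.factorial : ℝ) * (charlier (-a) k).eval (-(n : ℝ) - 1) =
        (n.factorial : ℝ)⁻¹ * ∑ i ∈ Finset.range (k + 1), (a ^ (k - i) * (k.choose i : ℝ)) *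
          ((-1) ^ i * ((n + i).factorial : ℝ)) := by
      rw [charlier_eval, neg_neg, mul_inv_cancel_left₀ hk, eq_inv_mul_iff_mul_eq₀ hn,
        Finset.mul_sum]
      refine Finset.sum_congr rfl fun i _ => ?_
      rw [← prod_range_neg_sub_mul_factorial]
      ring
    rw [mul_assoc _ (k.factorial : ℝ), mul_assoc _ (k.factorial : ℝ), hlhs, hrhs]
    have hsplit : ∑ j ∈ Finset.range (n + 1), ((-a) ^ (n - j) * (n.choose j : ℝ)) *
        (Real.exp a * factorialFunctional ((C a - X) ^ (k + j)) -
          (-1) ^ (k + j) * ((k + j).factorial : ℝ)) =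
        Real.exp a * ∑ j ∈ Finset.range (n + 1), ((-a) ^ (n - j) * (n.choose j : ℝ)) *
          factorialFunctional ((C a - X) ^ (k + j)) -
        (-1) ^ k * ∑ j ∈ Finset.range (n + 1), ((-a) ^ (n - j) * (n.choose j : ℝ)) *
          ((-1) ^ j * ((k + j).factorial : ℝ)) := by
      rw [Finset.mul_sum, Finset.mul_sum, ← Finset.sum_sub_distrib]
      exact Finset.sum_congr rfl fun j _ => by rw [pow_add (-1 : ℝ)]; ring
    rw [hsplit, sum_choose_mul_factorialFunctional]
    ring

/-- Lemma 4.3: `⟨ρ̃_{k,a}, c_n^a⟩ = (-1)^n e^a k! c_k^{-a}(-n-1)`. -/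
theorem stmt6 (k : ℕ) (hk : 1 ≤ k) (a : ℝ) (ha : a ≠ 0) (n : ℕ) :
    Summable (fun x : ℕ =>
      |a^(x+k+1) / (((x : ℝ) + k + 1) * x.factorial) * (charlier a n).eval (x : ℝ)|) ∧
    (-1:ℝ)^k * k.factorial * (charlier a n).eval (-(k : ℝ) - 1)
      + ∑' x : ℕ, a^(x+k+1) / (((x : ℝ) + k + 1) * x.factorial) * (charlier a n).eval (x : ℝ)
      = (-1:ℝ)^n * Real.exp a * k.factorial * (charlier (-a) k).eval (-(n : ℝ) - 1) := by
  have h := hasSum_charlier k a n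
  exact ⟨h.summable.abs, by rw [h.tsum_eq]; ring⟩
end

section
/- For all real numbers a ∉ {0,1}, c ∈ ℝ, every integer n ≥ 0 and all real x: (i) −Σ_{j=1}^{n} m_{n−j}^{a,c}(x) = (a/(1−a)) · (m_n^{a,c}(x+1) − m_n^{a,c}(x)); and (ii) Σ_{j=1}^{n} (−1)^{j+1} (−1/a)^{j} · m_{n−j}^{a,c}(x) = (1/(1−a)) · (m_n^{a,c}(x) − m_n^{a,c}(x−1)). Equivalently, the sequences ε_{n,1} = −1 and ε_{n,2} = −1/a define 𝒟-operators of type 1 for the Meixner family with 𝒟₁ = (a/(1−a))·Δ and 𝒟₂ = (1/(1−a))·∇. -/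
open Polynomial

/-- The generalized binomial coefficient `binom(y, j) = y(y-1)⋯(y-j+1)/j!` as a polynomial
in the (polynomial) argument `y`. -/
noncomputable def pbinom (y : ℝ[X]) (j : ℕ) : ℝ[X] :=
  C ((j.factorial : ℝ))⁻¹ * ∏ i ∈ Finset.range j, (y - C (i : ℝ))

/-- The Meixner polynomial `m_n^{a,c}(x) = (-1)^n ∑_{j=0}^n a^{-j} binom(x,j) binom(-x-c, n-j)`. -/
noncomputable def meixner (a c : ℝ) (n : ℕ) : ℝ[X] :=
  C ((-1:ℝ)^n) * ∑ j ∈ Finset.range (n+1),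
    C (a⁻¹ ^ j) * pbinom X j * pbinom (-X - C c) (n-j)

lemma eval_pbinom (p : ℝ[X]) (j : ℕ) (x : ℝ) :
    (pbinom p j).eval x = Ring.choose (p.eval x) j := by
  rw [Ring.choose_eq_smul, ← aeval_eq_smeval, aeval_def, ← eval_map,
    descPochhammer_map, descPochhammer_eval_eq_prod_range]
  simp [pbinom, Polynomial.eval_prod]

/-- The power series `(1 - b z) ^ y` in the variable `z`. -/
noncomputable def oneSubPow (b y : ℝ) : PowerSeries ℝ :=
  PowerSeries.mk fun j => (-b) ^ j * Ring.choose y j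

lemma oneSubPow_add_one (b y : ℝ) :
    oneSubPow b (y + 1) = (1 - PowerSeries.X * PowerSeries.C b) * oneSubPow b y := by
  ext n
  rw [sub_mul, one_mul, map_sub, mul_assoc]
  cases n with
  | zero => simp [oneSubPow]
  | succ n =>
    rw [PowerSeries.coeff_succ_X_mul, PowerSeries.coeff_C_mul]
    simp only [oneSubPow, PowerSeries.coeff_mk, Ring.choose_succ_succ]
    ring

/-- The generating function of the Meixner polynomials. -/
lemma mk_eval_meixner (a c x : ℝ) :
    PowerSeries.mk (fun n => (meixner a c n).eval x)
      = oneSubPow a⁻¹ x * oneSubPow 1 (-x - c) := by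
  ext n
  rw [PowerSeries.coeff_mul, Finset.Nat.sum_antidiagonal_eq_sum_range_succ_mk]
  simp only [oneSubPow, PowerSeries.coeff_mk, meixner, eval_mul, eval_C, eval_finsetSum,
    eval_pbinom, eval_X, eval_sub, eval_neg, Finset.mul_sum]
  refine Finset.sum_congr rfl fun j hj => ?_
  obtain ⟨k, rfl⟩ := Nat.exists_eq_add_of_le (Finset.mem_range_succ_iff.mp hj)
  rw [Nat.add_sub_cancel_left, pow_add, neg_pow a⁻¹]
  ring

lemma eval_meixner_zero (a c x : ℝ) : (meixner a c 0).eval x = 1 := by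
  simp [meixner, eval_pbinom]

lemma eval_meixner_succ_add_one (a c x : ℝ) (n : ℕ) :
    (meixner a c (n + 1)).eval (x + 1) - (meixner a c n).eval (x + 1)
      = (meixner a c (n + 1)).eval x - a⁻¹ * (meixner a c n).eval x := by
  have h : (1 - PowerSeries.X * PowerSeries.C 1) *
        PowerSeries.mk (fun n => (meixner a c n).eval (x + 1))
      = (1 - PowerSeries.X * PowerSeries.C a⁻¹) *
        PowerSeries.mk (fun n => (meixner a c n).eval x) := by
    rw [mk_eval_meixner, mk_eval_meixner, oneSubPow_add_one,
      show -x - c = -(x + 1) - c + 1 by ring, oneSubPow_add_one 1]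
    ring
  simpa [sub_mul, mul_assoc, PowerSeries.coeff_succ_X_mul] using
    congrArg (PowerSeries.coeff (n + 1)) h

lemma sum_Icc_one_succ_sub (f : ℕ → ℕ → ℝ) (n : ℕ) :
    ∑ j ∈ Finset.Icc 1 (n + 1), f j (n + 1 - j)
      = f 1 n + ∑ j ∈ Finset.Icc 1 n, f (j + 1) (n - j) := by
  rw [← Finset.Ico_add_one_right_eq_Icc, ← Finset.Ico_add_one_right_eq_Icc,
    Finset.sum_eq_sum_Ico_succ_bot (by omega), ← Finset.sum_Ico_add']
  simp

/-- Lemma 5.1: the sequences `ε_{n,1} = -1` and `ε_{n,2} = -1/a` define 𝒟-operators of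
type 1 for the Meixner family, equal to `(a/(1-a))Δ` and `(1/(1-a))∇` respectively. -/
theorem stmt9 (a : ℝ) (ha0 : a ≠ 0) (ha1 : a ≠ 1) (c : ℝ) (n : ℕ) (x : ℝ) :
    (-(∑ j ∈ Finset.Icc 1 n, (meixner a c (n-j)).eval x)
      = a / (1-a) * ((meixner a c n).eval (x+1) - (meixner a c n).eval x)) ∧
    (∑ j ∈ Finset.Icc 1 n, (-1:ℝ)^(j+1) * (-1/a)^j * (meixner a c (n-j)).eval x
      = 1 / (1-a) * ((meixner a c n).eval x - (meixner a c n).eval (x-1))) := by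
  have h1a : 1 - a ≠ 0 := sub_ne_zero.mpr ha1.symm
  constructor
  · induction n with
    | zero => simp [eval_meixner_zero]
    | succ n ih =>
      rw [sum_Icc_one_succ_sub fun _ k => (meixner a c k).eval x, neg_add, ih,
        sub_eq_iff_eq_add.mp (eval_meixner_succ_add_one a c x n)]
      field_simp
      ring
  · induction n with
    | zero => simp [eval_meixner_zero]
    | succ n ih =>
      have hshift : ∑ j ∈ Finset.Icc 1 n,
            (-1 : ℝ) ^ (j + 1 + 1) * (-1 / a) ^ (j + 1) * (meixner a c (n - j)).eval x
          = a⁻¹ * ∑ j ∈ Finset.Icc 1 n,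
            (-1 : ℝ) ^ (j + 1) * (-1 / a) ^ j * (meixner a c (n - j)).eval x := by
        rw [Finset.mul_sum]
        refine Finset.sum_congr rfl fun j _ => ?_
        ring
      have hrec := eval_meixner_succ_add_one a c (x - 1) n
      rw [sub_add_cancel] at hrec
      rw [sum_Icc_one_succ_sub
          fun j k => (-1 : ℝ) ^ (j + 1) * (-1 / a) ^ j * (meixner a c k).eval x,
        hshift, ih, sub_eq_iff_eq_add.mp hrec]
      field_simp
      ring
end

section
/- For all real numbers a ∉ {0,−1}, N ∈ ℝ, every integer n ≥ 0, and all real x: (i) Σ_{j=1}^{n} (−1)^{j+1} (1+a)^{−j} · k_{n−j}^{a,N}(x) = (1/(1+a)) · (k_n^{a,N}(x) − k_n^{a,N}(x−1)); and (ii) Σ_{j=1}^{n} (−1)^{j+1} (−a/(1+a))^{j} · k_{n−j}^{a,N}(x) = −(a/(1+a)) · (k_n^{a,N}(x+1) − k_n^{a,N}(x)). Equivalently, the sequences ε_{n,1} = 1/(1+a) and ε_{n,2} = −a/(1+a) define 𝒟-operators of type 1 for the Krawtchouk family with 𝒟₁ = (1/(1+a))·∇ and 𝒟₂ = −(a/(1+a))·Δ.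 -/
open Polynomial

/-- The Pochhammer symbol `(y)_j = y(y+1)⋯(y+j-1)` for a real `y`. -/
noncomputable def poch (y : ℝ) (j : ℕ) : ℝ := ∏ i ∈ Finset.range j, (y + i)

/-- The Krawtchouk polynomial
`k_n^{a,N}(x) = (1/n!) ∑_{j=0}^n (-1)^{n+j} ((1+a)/a)^{j-n} (-n)_j (-x)_j (N-n)_{n-j} / j!`. -/
noncomputable def krawtchouk (a N : ℝ) (n : ℕ) : ℝ[X] :=
  C ((n.factorial : ℝ))⁻¹ * ∑ j ∈ Finset.range (n+1),
    C ((-1:ℝ)^(n+j) * (a/(1+a))^(n-j) * poch (-(n : ℝ)) j * poch (N - n) (n-j)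
        / (j.factorial : ℝ)) * ∏ i ∈ Finset.range j, (-X + C (i : ℝ))

theorem poch_eq_factorial_mul_multichoose (y : ℝ) (j : ℕ) :
    poch y j = j.factorial * Ring.multichoose y j := by
  rw [← nsmul_eq_mul, Ring.factorial_nsmul_multichoose_eq_ascPochhammer,
    ascPochhammer_smeval_eq_eval, poch]
  induction j with
  | zero => simp
  | succ j ih => rw [Finset.prod_range_succ, ih, ascPochhammer_succ_eval]

theorem poch_neg (y : ℝ) (j : ℕ) :
    poch (-y) j = (-1) ^ j * j.factorial * Ring.choose y j := by
  have h := Ring.choose_neg' (-y) j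
  rw [neg_neg, Int.negOnePow_def, Units.smul_def, zsmul_eq_mul] at h
  push_cast [zpow_natCast] at h
  rw [poch_eq_factorial_mul_multichoose, h]
  have hs : ((-1 : ℝ) ^ j) * (-1) ^ j = 1 := by rw [← mul_pow]; simp
  linear_combination (-(j.factorial : ℝ) * Ring.multichoose (-y) j) * hs

/-- The coefficient of `Ring.choose x j` in the Krawtchouk polynomial of degree `j + m`, where
`c = a / (1 + a)`. -/
noncomputable def krawtchoukCoeff (c N : ℝ) (j m : ℕ) : ℝ :=
  (-c) ^ m * Ring.multichoose (N - (j + m)) m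

theorem krawtchoukCoeff_zero (c N : ℝ) (j : ℕ) : krawtchoukCoeff c N j 0 = 1 := by
  simp [krawtchoukCoeff]

theorem krawtchoukCoeff_succ_succ (c N : ℝ) (j m : ℕ) :
    krawtchoukCoeff c N (j + 1) (m + 1) =
      c * krawtchoukCoeff c N (j + 1) m + krawtchoukCoeff c N j (m + 1) := by
  have h := Ring.multichoose_succ_succ (N - (j + m + 2)) m
  rw [show N - ((j : ℝ) + m + 2) + 1 = N - (j + (m + 1)) by ring] at h
  simp only [krawtchoukCoeff]
  push_cast
  rw [show N - ((j : ℝ) + 1 + (m + 1)) = N - (j + m + 2) by ring,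
    show N - ((j : ℝ) + 1 + m) = N - (j + (m + 1)) by ring, h]
  ring

theorem krawtchouk_eval (a N : ℝ) (n : ℕ) (x : ℝ) :
    (krawtchouk a N n).eval x =
      ∑ j ∈ Finset.range (n + 1),
        Ring.choose x j * krawtchoukCoeff (a / (1 + a)) N j (n - j) := by
  rw [krawtchouk, eval_mul, eval_C, eval_finsetSum, Finset.mul_sum]
  refine Finset.sum_congr rfl fun j hj => ?_
  obtain ⟨m, rfl⟩ := Nat.exists_eq_add_of_le (Finset.mem_range_succ_iff.mp hj)
  have hp : eval x (∏ i ∈ Finset.range j, (-X + C (i : ℝ))) = poch (-x) j := by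
    simp [eval_prod, poch]
  have hc := Nat.choose_mul_factorial_mul_factorial (Nat.le_add_right j m)
  rw [Nat.add_sub_cancel_left] at hc ⊢
  have hc' : ((j + m).choose j : ℝ) * j.factorial * m.factorial = (j + m).factorial := by
    exact_mod_cast hc
  have hs : ((-1 : ℝ) ^ j) * (-1) ^ j = 1 := by rw [← mul_pow]; simp
  have hj0 : (j.factorial : ℝ) ≠ 0 := by positivity
  have hn0 : ((j + m).factorial : ℝ) ≠ 0 := by positivity
  rw [eval_mul, eval_C, hp, poch_neg, poch_neg, poch_eq_factorial_mul_multichoose,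
    Ring.choose_natCast, krawtchoukCoeff, neg_pow (a / (1 + a)), pow_add, pow_add]
  generalize a / (1 + a) = c
  push_cast
  generalize Ring.multichoose (N - ((j : ℝ) + m)) m = M
  rw [inv_mul_eq_div, div_eq_iff hn0, ← hc']
  field_simp
  linear_combination (c ^ m * (j + m).choose j * M * Ring.choose x j) *
    (((-1 : ℝ) ^ j) * (-1) ^ j + 1) * hs

/-- The forward-difference recurrence of the Krawtchouk polynomials in the degree. -/
theorem krawtchouk_succ_eval_add_one_sub (a N : ℝ) (n : ℕ) (x : ℝ) :
    (krawtchouk a N (n + 1)).eval (x + 1) - (krawtchouk a N (n + 1)).eval x =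
      a / (1 + a) * ((krawtchouk a N n).eval (x + 1) - (krawtchouk a N n).eval x) +
        (krawtchouk a N n).eval x := by
  have hD (k : ℕ) : (krawtchouk a N k).eval (x + 1) - (krawtchouk a N k).eval x =
      ∑ j ∈ Finset.range k,
        Ring.choose x j * krawtchoukCoeff (a / (1 + a)) N (j + 1) (k - (j + 1)) := by
    rw [krawtchouk_eval, krawtchouk_eval, Finset.sum_range_succ', Finset.sum_range_succ',
      Ring.choose_zero_right, Ring.choose_zero_right, add_sub_add_right_eq_sub,
      ← Finset.sum_sub_distrib]
    refine Finset.sum_congr rfl fun j _ => ?_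
    rw [Ring.choose_succ_succ]
    ring
  rw [hD, hD, krawtchouk_eval, Finset.sum_range_succ, Finset.sum_range_succ _ n, ← add_assoc,
    Finset.mul_sum, ← Finset.sum_add_distrib]
  congr 1
  · refine Finset.sum_congr rfl fun j hj => ?_
    obtain ⟨m, rfl⟩ := Nat.exists_eq_add_of_lt (Finset.mem_range.mp hj)
    rw [show j + m + 1 + 1 - (j + 1) = m + 1 by lia, show j + m + 1 - (j + 1) = m by lia,
      show j + m + 1 - j = m + 1 by lia, krawtchoukCoeff_succ_succ]
    ring
  · simp [krawtchoukCoeff_zero]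

theorem krawtchouk_zero_eval (a N x : ℝ) : (krawtchouk a N 0).eval x = 1 := by
  simp [krawtchouk_eval, krawtchoukCoeff_zero]

/-- An alternating geometric convolution is determined by its first-order recurrence. -/
theorem sum_Icc_alternating_eq (e : ℝ) (f g : ℕ → ℝ) (h0 : g 0 = 0)
    (hg : ∀ n, g (n + 1) = e * f n - e * g n) (n : ℕ) :
    ∑ j ∈ Finset.Icc 1 n, (-1 : ℝ) ^ (j + 1) * e ^ j * f (n - j) = g n := by
  rw [← Finset.Ico_add_one_right_eq_Icc, Finset.sum_Ico_eq_sum_range, Nat.add_sub_cancel]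
  induction n with
  | zero => simp [h0]
  | succ n ih =>
    rw [Finset.sum_range_succ', hg, ← ih, Finset.mul_sum, sub_eq_add_neg, add_comm,
      ← Finset.sum_neg_distrib]
    congr 1
    · simp
    · refine Finset.sum_congr rfl fun j _ => ?_
      rw [show n + 1 - (1 + (j + 1)) = n - (1 + j) by lia]
      ring

/-- Lemma 6.1: the sequences `ε_{n,1} = 1/(1+a)` and `ε_{n,2} = -a/(1+a)` define
𝒟-operators of type 1 for the Krawtchouk family, equal to `(1/(1+a))∇` and
`-(a/(1+a))Δ` respectively. -/
theorem stmt13 (a : ℝ) (ha0 : a ≠ 0) (ha1 : a ≠ -1) (N : ℝ) (n : ℕ) (x : ℝ) :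
    (∑ j ∈ Finset.Icc 1 n, (-1:ℝ)^(j+1) * ((1+a)⁻¹)^j * (krawtchouk a N (n-j)).eval x
      = 1/(1+a) * ((krawtchouk a N n).eval x - (krawtchouk a N n).eval (x-1))) ∧
    (∑ j ∈ Finset.Icc 1 n, (-1:ℝ)^(j+1) * (-a/(1+a))^j * (krawtchouk a N (n-j)).eval x
      = -(a/(1+a)) * ((krawtchouk a N n).eval (x+1) - (krawtchouk a N n).eval x)) := by
  have h1 : 1 + a ≠ 0 := fun h => ha1 (by linarith)
  constructor
  · refine sum_Icc_alternating_eq _ (fun k => (krawtchouk a N k).eval x)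
      (fun k => 1/(1+a) * ((krawtchouk a N k).eval x - (krawtchouk a N k).eval (x-1)))
      (by simp [krawtchouk_zero_eval]) (fun k => ?_) n
    have h := krawtchouk_succ_eval_add_one_sub a N k (x - 1)
    rw [sub_add_cancel] at h
    simp only [h]
    field_simp
    ring
  · refine sum_Icc_alternating_eq _ (fun k => (krawtchouk a N k).eval x)
      (fun k => -(a/(1+a)) * ((krawtchouk a N k).eval (x+1) - (krawtchouk a N k).eval x))
      (by simp [krawtchouk_zero_eval]) (fun k => ?_) n
    simp only [krawtchouk_succ_eval_add_one_sub]
    ring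
end
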